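/- arXiv:2007.10832 — 3 statements merged into one kernel-verified Lean document; each statement's English description precedes it below -/
import Mathlib

section
/- Let H be an ordered graph on h vertices with at least one edge. Then for every positive integer n divisible by h, there exists an ordered graph G on vertex set [n] with minimum degree δ(G) ≥ ⌊(1−α*(H))n⌋ − 1 that does not contain a perfect H-tiling. -/
open Finset

section Defs

variable {h n : ℕ}

/-- `φ` is an order-preserving embedding of the ordered graph `H` into the ordered graph `G`:
a strictly increasing map carrying edges of `H` to edges of `G`. -/
def IsOrderedCopy (H : SimpleGraph (Fin h)) (G : SimpleGraph (Fin n))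
    (φ : Fin h → Fin n) : Prop :=
  StrictMono φ ∧ ∀ i j : Fin h, H.Adj i j → G.Adj (φ i) (φ j)

/-- `S` is the vertex set of a copy of the ordered graph `H` in the ordered graph `G`. -/
def IsCopySet (H : SimpleGraph (Fin h)) (G : SimpleGraph (Fin n))
    (S : Finset (Fin n)) : Prop :=
  ∃ φ : Fin h → Fin n, IsOrderedCopy H G φ ∧ Finset.image φ Finset.univ = S

/-- `G` has an `H`-tiling (vertex-disjoint copies of `H`) whose copies exactly cover the
vertex set `S`; equivalently, the induced ordered subgraph `G[S]` has a perfect `H`-tiling. -/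
def HasPerfectTilingOn (H : SimpleGraph (Fin h)) (G : SimpleGraph (Fin n))
    (S : Finset (Fin n)) : Prop :=
  ∃ 𝒯 : Finset (Finset (Fin n)),
    (∀ T ∈ 𝒯, IsCopySet H G T) ∧
    (𝒯 : Set (Finset (Fin n))).PairwiseDisjoint id ∧
    𝒯.biUnion id = S

/-- `G` has a perfect `H`-tiling. -/
def HasPerfectTiling (H : SimpleGraph (Fin h)) (G : SimpleGraph (Fin n)) : Prop :=
  HasPerfectTilingOn H G Finset.univ

/-- The degree of a vertex in an ordered graph. -/
noncomputable def odeg (G : SimpleGraph (Fin n)) (v : Fin n) : ℕ :=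
  (G.neighborSet v).ncard

/-- `[h]` can be partitioned into `k` intervals, each independent in `H`
(expressed via a monotone colouring with independent fibres). -/
def HasIntervalColoring (H : SimpleGraph (Fin h)) (k : ℕ) : Prop :=
  ∃ c : Fin h → Fin k, Monotone c ∧ ∀ i j : Fin h, H.Adj i j → c i ≠ c j

/-- The interval chromatic number `χ<(H)` of an ordered graph. -/
noncomputable def intervalChi (H : SimpleGraph (Fin h)) : ℕ :=
  sInf {k | HasIntervalColoring H k}

/-- `α⁺ᵢ(H)`: `α⁺₀ = 0`, and `α⁺_{i+1}` is the largest `k ≤ h` such that the interval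
`[α⁺ᵢ + 1, k]` is independent in `H` (vertices are 1-indexed via `v ↦ (v : ℕ) + 1`). -/
noncomputable def alphaPlus (H : SimpleGraph (Fin h)) : ℕ → ℕ
  | 0 => 0
  | (i + 1) => sSup {k | k ≤ h ∧ ∀ a b : Fin h,
      alphaPlus H i + 1 ≤ (a : ℕ) + 1 → (a : ℕ) + 1 ≤ k →
      alphaPlus H i + 1 ≤ (b : ℕ) + 1 → (b : ℕ) + 1 ≤ k → ¬ H.Adj a b}

/-- `α⁻ᵢ(H)`: `α⁻₀ = h + 1`, and `α⁻_{i+1}` is the smallest `k ≥ 1` such that the interval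
`[k, α⁻ᵢ − 1]` is independent in `H`. -/
noncomputable def alphaMinus (H : SimpleGraph (Fin h)) : ℕ → ℕ
  | 0 => h + 1
  | (i + 1) => sInf {k | 1 ≤ k ∧ ∀ a b : Fin h,
      k ≤ (a : ℕ) + 1 → (a : ℕ) + 1 ≤ alphaMinus H i - 1 →
      k ≤ (b : ℕ) + 1 → (b : ℕ) + 1 ≤ alphaMinus H i - 1 → ¬ H.Adj a b}

/-- `α*(H) = min over 1 ≤ ℓ < χ<(H) of min{α⁺_ℓ/(ℓh), (h − α⁻_ℓ + 1)/(ℓh)}`. -/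
noncomputable def alphaStar (H : SimpleGraph (Fin h)) : ℝ :=
  sInf {x : ℝ | ∃ ℓ : ℕ, 1 ≤ ℓ ∧ ℓ < intervalChi H ∧
    (x = (alphaPlus H ℓ : ℝ) / (ℓ * h) ∨
     x = ((h : ℝ) - alphaMinus H ℓ + 1) / (ℓ * h))}

/-- `α*(H)` for ordered graphs with interval chromatic number 2:
`min{α⁺₁(H)/h, (h − α⁻₁(H) + 1)/h}`. -/
noncomputable def alphaStar2 (H : SimpleGraph (Fin h)) : ℝ :=
  min ((alphaPlus H 1 : ℝ) / h) (((h : ℝ) - alphaMinus H 1 + 1) / h)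

/-- Property A: no edges of `H` within `[1, ⌊h/2⌋ + 1]` nor within `[⌈h/2⌉, h]`. -/
def PropertyA (H : SimpleGraph (Fin h)) : Prop :=
  (∀ a b : Fin h, (a : ℕ) + 1 ≤ h / 2 + 1 → (b : ℕ) + 1 ≤ h / 2 + 1 → ¬ H.Adj a b) ∧
  (∀ a b : Fin h, (h + 1) / 2 ≤ (a : ℕ) + 1 → (h + 1) / 2 ≤ (b : ℕ) + 1 → ¬ H.Adj a b)

/-- Property B: for each partition of `[h]` into nonempty intervals `[1, i], [i+1, h]`
there is an edge of `H` between them. -/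
def PropertyB (H : SimpleGraph (Fin h)) : Prop :=
  ∀ i : ℕ, 1 ≤ i → i < h →
    ∃ a b : Fin h, H.Adj a b ∧ (a : ℕ) + 1 ≤ i ∧ i + 1 ≤ (b : ℕ) + 1

/-- `s(H)`: the smallest vertex adjacent to `h`, and `0` if `h` is isolated. -/
noncomputable def sOG (H : SimpleGraph (Fin h)) : ℕ :=
  sInf {k | ∃ a b : Fin h, H.Adj a b ∧ (a : ℕ) + 1 = k ∧ (b : ℕ) + 1 = h}

open Classical in
/-- `l(H)`: the largest vertex adjacent to `1`, and `h + 1` if `1` is isolated. -/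
noncomputable def lOG (H : SimpleGraph (Fin h)) : ℕ :=
  if ∃ a b : Fin h, H.Adj a b ∧ (a : ℕ) + 1 = 1 then
    sSup {k | ∃ a b : Fin h, H.Adj a b ∧ (a : ℕ) + 1 = 1 ∧ (b : ℕ) + 1 = k}
  else h + 1

/-- The vertex `h` has Property C: `s(H) ≥ 1` and there is an edge within `[s(H), h − 1]`. -/
def PropertyCLast (H : SimpleGraph (Fin h)) : Prop :=
  1 ≤ sOG H ∧ ∃ a b : Fin h, H.Adj a b ∧
    sOG H ≤ (a : ℕ) + 1 ∧ (a : ℕ) + 1 ≤ h - 1 ∧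
    sOG H ≤ (b : ℕ) + 1 ∧ (b : ℕ) + 1 ≤ h - 1

/-- The vertex `1` has Property C: `l(H) ≤ h` and there is an edge within `[2, l(H)]`. -/
def PropertyCFirst (H : SimpleGraph (Fin h)) : Prop :=
  lOG H ≤ h ∧ ∃ a b : Fin h, H.Adj a b ∧
    2 ≤ (a : ℕ) + 1 ∧ (a : ℕ) + 1 ≤ lOG H ∧
    2 ≤ (b : ℕ) + 1 ∧ (b : ℕ) + 1 ≤ lOG H

/-- `S` is an `H`-absorbing set for `W`: both `G[S]` and `G[S ∪ W]` have perfect `H`-tilings. -/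
def IsAbsorbingFor (H : SimpleGraph (Fin h)) (G : SimpleGraph (Fin n))
    (S W : Finset (Fin n)) : Prop :=
  HasPerfectTilingOn H G S ∧ HasPerfectTilingOn H G (S ∪ W)

end Defs

section Regularity

/-- The density `d(A,B) = e(A,B)/(|A||B|)` of a pair of vertex sets in a graph. -/
noncomputable def pairDensity {V : Type*} (G : SimpleGraph V) (A B : Finset V) : ℝ :=
  ({e : V × V | e.1 ∈ A ∧ e.2 ∈ B ∧ G.Adj e.1 e.2}.ncard : ℝ) /
    ((A.card : ℝ) * (B.card : ℝ))

/-- The pair `(A, B)` is `ε`-regular in `G`. -/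
def IsRegularPair {V : Type*} (G : SimpleGraph V) (A B : Finset V) (ε : ℝ) : Prop :=
  ∀ X ⊆ A, ∀ Y ⊆ B, ε * A.card ≤ (X.card : ℝ) → ε * B.card ≤ (Y.card : ℝ) →
    |pairDensity G A B - pairDensity G X Y| < ε

end Regularity

section Bottle

/-- The chromatic number of a finite graph. -/
noncomputable def chromNum {m : ℕ} (B : SimpleGraph (Fin m)) : ℕ :=
  sInf {k | ∃ c : Fin m → Fin k, ∀ x y : Fin m, B.Adj x y → c x ≠ c y}

/-- `σ(B)`: the smallest size of a colour class in any proper colouring of `B`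
with `χ(B)` colours. -/
noncomputable def sigmaMinCl {m : ℕ} (B : SimpleGraph (Fin m)) : ℕ :=
  sInf {c | ∃ C : Fin m → Fin (chromNum B),
    (∀ x y : Fin m, B.Adj x y → C x ≠ C y) ∧
    ∃ i : Fin (chromNum B), c = (Finset.univ.filter (fun v => C v = i)).card}

/-- The critical chromatic number `χ_cr(B) = (χ(B) − 1)·|B|/(|B| − σ(B))`. -/
noncomputable def critChrom {m : ℕ} (B : SimpleGraph (Fin m)) : ℝ :=
  ((chromNum B : ℝ) - 1) * m / ((m : ℝ) - sigmaMinCl B)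

/-- `φ` is an interval labeling of the complete multipartite graph with part function `p`
(with respect to some permutation `σ` of the parts). -/
def IsIntervalLabeling {m k : ℕ} (p : Fin m → Fin k) (φ : Equiv.Perm (Fin m)) : Prop :=
  ∃ σ : Equiv.Perm (Fin k), ∀ x y : Fin m, σ (p x) < σ (p y) → φ x < φ y

/-- `G` is (an isomorphic realisation of) the ordered blow-up `(B(t), φ)` of the complete
multipartite graph `B` with part function `p`: there is a block assignment `β` whose fibres
all have size `t`, compatible with the order induced by `φ`, with adjacency between blocks
given by `B`. -/
def IsOrderedBlowup {m k : ℕ} (p : Fin m → Fin k) (φ : Equiv.Perm (Fin m)) (t : ℕ)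
    {N : ℕ} (G : SimpleGraph (Fin N)) : Prop :=
  ∃ β : Fin N → Fin m,
    (∀ x : Fin m, {u : Fin N | β u = x}.ncard = t) ∧
    (∀ u v : Fin N, u ≤ v → φ (β u) ≤ φ (β v)) ∧
    (∀ u v : Fin N, G.Adj u v ↔ p (β u) ≠ p (β v))

/-- The complete multipartite graph with part function `p` is a bottlegraph assigned to `H`:
for every interval labeling `φ` there is a `t ≥ 1` such that the ordered blow-up `(B(t), φ)`
has a perfect `H`-tiling. -/
def IsBottlegraph {h m k : ℕ} (H : SimpleGraph (Fin h)) (p : Fin m → Fin k) : Prop :=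
  ∀ φ : Equiv.Perm (Fin m), IsIntervalLabeling p φ →
    ∃ t : ℕ, 0 < t ∧ ∀ (N : ℕ) (G : SimpleGraph (Fin N)),
      IsOrderedBlowup p φ t G → HasPerfectTiling H G

end Bottle

/-- The set of right endpoints whose supremum defines `alphaPlus H (i + 1)`. -/
def alphaPlusSet {h : ℕ} (H : SimpleGraph (Fin h)) (s : ℕ) : Set ℕ :=
  {k | k ≤ h ∧ ∀ a b : Fin h,
      s + 1 ≤ (a : ℕ) + 1 → (a : ℕ) + 1 ≤ k →
      s + 1 ≤ (b : ℕ) + 1 → (b : ℕ) + 1 ≤ k → ¬ H.Adj a b}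

theorem alphaPlus_succ {h : ℕ} (H : SimpleGraph (Fin h)) (i : ℕ) :
    alphaPlus H (i + 1) = sSup (alphaPlusSet H (alphaPlus H i)) := rfl

theorem bddAbove_alphaPlusSet {h : ℕ} (H : SimpleGraph (Fin h)) (s : ℕ) :
    BddAbove (alphaPlusSet H s) := ⟨h, fun _ hk => hk.1⟩

theorem alphaPlus_succ_mem {h : ℕ} (H : SimpleGraph (Fin h)) (i : ℕ) :
    alphaPlus H (i + 1) ∈ alphaPlusSet H (alphaPlus H i) :=
  Nat.sSup_mem ⟨0, Nat.zero_le _, fun _ _ _ h0 => by omega⟩ (bddAbove_alphaPlusSet H _)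

theorem le_alphaPlus_succ {h : ℕ} {H : SimpleGraph (Fin h)} {i k : ℕ}
    (hk : k ∈ alphaPlusSet H (alphaPlus H i)) : k ≤ alphaPlus H (i + 1) :=
  le_csSup (bddAbove_alphaPlusSet H _) hk

theorem alphaPlus_le {h : ℕ} (H : SimpleGraph (Fin h)) : ∀ i, alphaPlus H i ≤ h
  | 0 => Nat.zero_le _
  | i + 1 => (alphaPlus_succ_mem H i).1

/-- If the greedy intervals exhaust `[h]` after `ℓ` steps, they form an interval colouring. -/
theorem hasIntervalColoring_of_le_alphaPlus {h : ℕ} {H : SimpleGraph (Fin h)} {ℓ : ℕ}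
    (hℓ : h ≤ alphaPlus H ℓ) : HasIntervalColoring H ℓ := by
  classical
  have hex : ∀ i : Fin h, ∃ j, (i : ℕ) < alphaPlus H j := fun i => ⟨ℓ, i.2.trans_le hℓ⟩
  have hpos : ∀ i : Fin h, 1 ≤ Nat.find (hex i) := by
    intro i
    by_contra! h0
    have h1 := Nat.find_spec (hex i)
    rw [Nat.lt_one_iff.mp h0] at h1
    exact Nat.not_lt_zero _ h1
  have hle : ∀ i : Fin h, Nat.find (hex i) ≤ ℓ := fun i => Nat.find_min' _ (i.2.trans_le hℓ)
  refine ⟨fun i => ⟨Nat.find (hex i) - 1, by have := hpos i; have := hle i; omega⟩, ?_, ?_⟩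
  · intro i j hij
    have h1 : Nat.find (hex i) ≤ Nat.find (hex j) :=
      Nat.find_min' _ (lt_of_le_of_lt hij (Nat.find_spec (hex j)))
    exact Fin.mk_le_mk.mpr (Nat.sub_le_sub_right h1 1)
  · intro i j hadj hc
    have hc' : Nat.find (hex i) - 1 = Nat.find (hex j) - 1 := congrArg Fin.val hc
    obtain ⟨c, hci⟩ : ∃ c, Nat.find (hex i) = c + 1 := ⟨_, (Nat.sub_add_cancel (hpos i)).symm⟩
    have hcj : Nat.find (hex j) = c + 1 := by have := hpos j; omega
    have hi := Nat.find_spec (hex i)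
    have hj := Nat.find_spec (hex j)
    have hi' := Nat.find_min (hex i) (m := c) (by omega)
    have hj' := Nat.find_min (hex j) (m := c) (by omega)
    rw [hci] at hi
    rw [hcj] at hj
    exact (alphaPlus_succ_mem H c).2 i j (by omega) hi (by omega) hj hadj

theorem alphaPlus_lt_of_lt_intervalChi {h : ℕ} {H : SimpleGraph (Fin h)} {ℓ : ℕ}
    (hℓ : ℓ < intervalChi H) : alphaPlus H ℓ < h := by
  by_contra! hle
  exact Nat.notMem_of_lt_sInf hℓ (hasIntervalColoring_of_le_alphaPlus hle)

theorem HasIntervalColoring.comap_rev {h k : ℕ} {H : SimpleGraph (Fin h)}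
    (hk : HasIntervalColoring H k) : HasIntervalColoring (H.comap Fin.rev) k := by
  obtain ⟨c, hmono, hc⟩ := hk
  refine ⟨fun i => (c i.rev).rev, fun i j hij => Fin.rev_le_rev.mpr (hmono (Fin.rev_le_rev.mpr hij)),
    fun i j hadj heq => hc _ _ hadj (Fin.rev_injective heq)⟩

theorem comap_rev_comap_rev {h : ℕ} (H : SimpleGraph (Fin h)) :
    (H.comap Fin.rev).comap Fin.rev = H := by
  ext a b
  simp

theorem intervalChi_comap_rev {h : ℕ} (H : SimpleGraph (Fin h)) :
    intervalChi (H.comap Fin.rev) = intervalChi H := by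
  unfold intervalChi
  congr 1
  ext k
  exact ⟨fun hk => comap_rev_comap_rev H ▸ hk.comap_rev, fun hk => hk.comap_rev⟩

/-- Reversing the order exchanges `α⁻` with `α⁺`. -/
theorem alphaMinus_add_alphaPlus_comap_rev {h : ℕ} (H : SimpleGraph (Fin h)) (i : ℕ) :
    alphaMinus H i + alphaPlus (H.comap Fin.rev) i = h + 1 := by
  induction i with
  | zero => simp [alphaMinus, alphaPlus]
  | succ i ih =>
    have hp := alphaPlus_succ_mem (H.comap Fin.rev) i
    have hle := alphaPlus_le (H.comap Fin.rev) i
    have hleast : IsLeast {k | 1 ≤ k ∧ ∀ a b : Fin h,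
        k ≤ (a : ℕ) + 1 → (a : ℕ) + 1 ≤ alphaMinus H i - 1 →
        k ≤ (b : ℕ) + 1 → (b : ℕ) + 1 ≤ alphaMinus H i - 1 → ¬ H.Adj a b}
        (h + 1 - alphaPlus (H.comap Fin.rev) (i + 1)) := by
      have hp1 := hp.1
      refine ⟨⟨by omega, fun a b ha ha' hb hb' hadj => ?_⟩, fun k hk => ?_⟩
      · refine hp.2 a.rev b.rev ?_ ?_ ?_ ?_ (by simpa using hadj) <;>
          simp only [Fin.val_rev] <;> omega
      · by_contra! hlt
        have hmem : h + 1 - k ∈ alphaPlusSet (H.comap Fin.rev)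
            (alphaPlus (H.comap Fin.rev) i) := by
          have hk1 := hk.1
          refine ⟨by omega, fun a b ha ha' hb hb' hadj => ?_⟩
          refine hk.2 a.rev b.rev ?_ ?_ ?_ ?_ hadj <;>
            simp only [Fin.val_rev] <;> omega
        have := le_alphaPlus_succ hmem
        omega
    have heq : alphaMinus H (i + 1) = h + 1 - alphaPlus (H.comap Fin.rev) (i + 1) :=
      hleast.csInf_eq
    have := hp.1
    omega

theorem two_le_intervalChi {h : ℕ} {H : SimpleGraph (Fin h)}
    (hedge : ∃ a b : Fin h, H.Adj a b) : 2 ≤ intervalChi H := by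
  obtain ⟨a, b, hab⟩ := hedge
  have hmem : HasIntervalColoring H (intervalChi H) :=
    Nat.sInf_mem (s := {k | HasIntervalColoring H k})
      ⟨h, id, monotone_id, fun i j hij => hij.ne⟩
  obtain ⟨c, -, hc⟩ := hmem
  have h1 : (c a : ℕ) ≠ c b := fun he => hc a b hab (Fin.ext he)
  have := (c a).2
  have := (c b).2
  omega

/-- A vertex set too large for its maximum intersection with copies obstructs perfect tilings. -/
theorem not_hasPerfectTiling_of_card_inter_le {h n m a : ℕ} {H : SimpleGraph (Fin h)}
    {G : SimpleGraph (Fin n)} (A : Finset (Fin n)) (hh : 0 < h) (hnm : n = h * m)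
    (hcopy : ∀ φ, IsOrderedCopy H G φ → #{i | φ i ∈ A} ≤ a) (hA : m * a < #A) :
    ¬ HasPerfectTiling H G := by
  rintro ⟨𝒯, hT, hdisj, hcov⟩
  have hsize : ∀ T ∈ 𝒯, #T = h := by
    intro T hTm
    obtain ⟨φ, hφ, rfl⟩ := hT T hTm
    rw [card_image_of_injective _ hφ.1.injective, card_univ, Fintype.card_fin]
  have hcard : #𝒯 = m := by
    have h1 := card_biUnion (s := 𝒯) (t := id) hdisj
    rw [hcov, card_univ, Fintype.card_fin, sum_const_nat (m := h) (f := fun T => #(id T)) hsize] at h1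
    exact Nat.eq_of_mul_eq_mul_right hh (h1.symm.trans (hnm.trans (mul_comm h m)))
  have hinter : ∀ T ∈ 𝒯, #(A ∩ T) ≤ a := by
    intro T hTm
    obtain ⟨φ, hφ, rfl⟩ := hT T hTm
    refine le_trans ?_ (hcopy φ hφ)
    refine le_trans (card_le_card ?_) (card_image_le (f := φ))
    intro x hx
    simp only [mem_inter, mem_image, mem_univ, true_and] at hx
    obtain ⟨hxA, i, rfl⟩ := hx
    exact mem_image_of_mem _ (by simpa using hxA)
  have hle : #A ≤ ∑ T ∈ 𝒯, #(A ∩ T) := by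
    calc #A = #(𝒯.biUnion fun T => A ∩ T) := by
          rw [← inter_biUnion]
          have : 𝒯.biUnion (fun T => T) = univ := hcov
          rw [this, inter_univ]
      _ ≤ _ := card_biUnion_le
  have := hle.trans (sum_le_card_nsmul _ _ _ hinter)
  rw [hcard, smul_eq_mul] at this
  omega

/-- The ordered graph in which the first `X` vertices are split into independent intervals
of length `q`, and all other pairs are edges. -/
def intervalBarrier (n X q : ℕ) : SimpleGraph (Fin n) where
  Adj u v := u ≠ v ∧ ¬ ((u : ℕ) < X ∧ (v : ℕ) < X ∧ (u : ℕ) / q = (v : ℕ) / q)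
  symm := ⟨fun _ _ huv => ⟨huv.1.symm, fun hc => huv.2 ⟨hc.2.1, hc.1, hc.2.2.symm⟩⟩⟩
  loopless := ⟨fun _ hu => hu.1 rfl⟩

theorem le_odeg_intervalBarrier {n q : ℕ} (X : ℕ) (hq : 0 < q) (v : Fin n) :
    n ≤ odeg (intervalBarrier n X q) v + q := by
  classical
  have hcompl : #{u : Fin n | ¬ (intervalBarrier n X q).Adj v u} ≤ q := by
    rw [← card_map Fin.valEmbedding]
    refine (card_le_card (t := Ico ((v : ℕ) / q * q) ((v : ℕ) / q * q + q)) ?_).trans (by simp)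
    intro x hx
    simp only [mem_map, mem_filter, mem_univ, true_and, Fin.valEmbedding_apply] at hx
    obtain ⟨u, hu, rfl⟩ := hx
    have huv : (u : ℕ) / q = (v : ℕ) / q := by
      by_contra hne
      exact hu ⟨fun he => hne (by rw [he]), fun hc => hne hc.2.2.symm⟩
    rw [mem_Ico, ← huv]
    exact ⟨Nat.div_mul_le_self _ _, Nat.lt_div_mul_add hq⟩
  have hdeg : odeg (intervalBarrier n X q) v = #{u : Fin n | (intervalBarrier n X q).Adj v u} := by
    rw [odeg, ← Set.ncard_coe_finset]
    congr 1
    ext u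
    simp
  have := card_filter_add_card_filter_not (s := (univ : Finset (Fin n)))
    (fun u => (intervalBarrier n X q).Adj v u)
  rw [card_univ, Fintype.card_fin] at this
  omega

/-- A copy of `H` meets the first `j` intervals of the barrier in at most `α⁺ⱼ(H)` vertices. -/
theorem lt_alphaPlus_of_isOrderedCopy {h n X q : ℕ} {H : SimpleGraph (Fin h)} (hq : 0 < q)
    {φ : Fin h → Fin n} (hφ : IsOrderedCopy H (intervalBarrier n X q) φ) (j : ℕ) :
    ∀ i : Fin h, (φ i : ℕ) < X → (φ i : ℕ) < j * q → (i : ℕ) < alphaPlus H j := by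
  induction j with
  | zero => intro i _ h0; omega
  | succ j ih =>
    intro i hiX hij
    refine le_alphaPlus_succ ⟨i.2, fun a b ha ha' hb hb' hadj => (hφ.2 a b hadj).2 ?_⟩
    have key : ∀ c : Fin h, alphaPlus H j + 1 ≤ (c : ℕ) + 1 → (c : ℕ) + 1 ≤ (i : ℕ) + 1 →
        (φ c : ℕ) < X ∧ (φ c : ℕ) / q = j := by
      intro c hc hc'
      have hle : (φ c : ℕ) ≤ φ i := hφ.1.monotone (Fin.le_def.mpr (by omega))
      refine ⟨by omega, le_antisymm (Nat.lt_succ_iff.mp ?_) ?_⟩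
      · exact (Nat.div_lt_iff_lt_mul hq).mpr (hle.trans_lt hij)
      · rw [Nat.le_div_iff_mul_le hq]
        by_contra! hlt
        have := ih c (by omega) hlt
        omega
    obtain ⟨haX, haq⟩ := key a ha ha'
    obtain ⟨hbX, hbq⟩ := key b hb hb'
    exact ⟨haX, hbX, haq.trans hbq.symm⟩

theorem exists_not_hasPerfectTiling_alphaPlus {h n m ℓ : ℕ} {H : SimpleGraph (Fin h)}
    (hm : 0 < m) (hnm : n = h * m) (hℓ : 1 ≤ ℓ) (hχ : ℓ < intervalChi H) :
    ∃ (G : SimpleGraph (Fin n)) (A : Finset (Fin n)),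
      (∀ v, n ≤ odeg G v + (m * alphaPlus H ℓ / ℓ + 1)) ∧
      (∀ φ, IsOrderedCopy H G φ → #{i | φ i ∈ A} ≤ alphaPlus H ℓ) ∧
      m * alphaPlus H ℓ < #A := by
  have hlt := alphaPlus_lt_of_lt_intervalChi hχ
  set α := alphaPlus H ℓ with hα
  set q := m * α / ℓ + 1 with hqdef
  have hX : m * α + 1 ≤ n := by
    rw [hnm, mul_comm h]
    exact Nat.mul_lt_mul_of_pos_left hlt hm
  refine ⟨intervalBarrier n (m * α + 1) q, univ.filter fun v : Fin n => (v : ℕ) < m * α + 1,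
    le_odeg_intervalBarrier _ (Nat.succ_pos _), fun φ hφ => ?_, ?_⟩
  · have hXq : m * α + 1 ≤ ℓ * q := by
      exact Nat.lt_mul_div_succ _ hℓ
    rw [← card_map Fin.valEmbedding]
    refine (card_le_card (t := range α) ?_).trans (by simp)
    intro x hx
    simp only [mem_map, mem_filter, mem_univ, true_and, Fin.valEmbedding_apply] at hx
    obtain ⟨i, hi, rfl⟩ := hx
    exact mem_range.mpr
      (lt_alphaPlus_of_isOrderedCopy (Nat.succ_pos _) hφ ℓ i hi (hi.trans_le hXq))
  · rw [Fin.card_filter_val_lt]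
    omega

theorem odeg_comap_rev {n : ℕ} (G : SimpleGraph (Fin n)) (v : Fin n) :
    odeg (G.comap Fin.rev) v = odeg G v.rev := by
  have : (G.comap Fin.rev).neighborSet v = Fin.rev '' G.neighborSet v.rev := by
    ext u
    simp only [SimpleGraph.mem_neighborSet, SimpleGraph.comap_adj, Set.mem_image]
    exact ⟨fun hu => ⟨u.rev, hu, Fin.rev_rev u⟩, by rintro ⟨w, hw, rfl⟩; simpa using hw⟩
  rw [odeg, odeg, this, Set.ncard_image_of_injective _ Fin.rev_injective]

theorem IsOrderedCopy.rev {h n : ℕ} {H : SimpleGraph (Fin h)} {G : SimpleGraph (Fin n)}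
    {φ : Fin h → Fin n} (hφ : IsOrderedCopy H (G.comap Fin.rev) φ) :
    IsOrderedCopy (H.comap Fin.rev) G (fun i => (φ i.rev).rev) :=
  ⟨fun _ _ hij => Fin.rev_lt_rev.mpr (hφ.1 (Fin.rev_lt_rev.mpr hij)),
    fun _ _ hij => hφ.2 _ _ hij⟩

theorem exists_not_hasPerfectTiling_alphaMinus {h n m ℓ : ℕ} {H : SimpleGraph (Fin h)}
    (hm : 0 < m) (hnm : n = h * m) (hℓ : 1 ≤ ℓ) (hχ : ℓ < intervalChi H) :
    ∃ (G : SimpleGraph (Fin n)) (A : Finset (Fin n)),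
      (∀ v, n ≤ odeg G v + (m * alphaPlus (H.comap Fin.rev) ℓ / ℓ + 1)) ∧
      (∀ φ, IsOrderedCopy H G φ → #{i | φ i ∈ A} ≤ alphaPlus (H.comap Fin.rev) ℓ) ∧
      m * alphaPlus (H.comap Fin.rev) ℓ < #A := by
  obtain ⟨G, A, hdeg, hcopy, hA⟩ := exists_not_hasPerfectTiling_alphaPlus hm hnm hℓ
    ((intervalChi_comap_rev H).symm ▸ hχ)
  refine ⟨G.comap Fin.rev, A.map Fin.revPerm.toEmbedding, fun v => ?_, fun φ hφ => ?_, ?_⟩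
  · rw [odeg_comap_rev]
    exact hdeg _
  · refine le_trans ?_ (hcopy _ hφ.rev)
    rw [← card_map Fin.revPerm.toEmbedding]
    refine card_le_card fun i hi => ?_
    simp only [mem_map_equiv, mem_filter, mem_univ, true_and, Fin.revPerm_symm,
      Fin.revPerm_apply] at hi ⊢
    exact hi
  · rwa [card_map]

/-- The minimum defining `α*` is attained; by `α⁻` being the reversal of `α⁺`, it is always
of the form `α⁺_ℓ / (ℓ h)` for `H` or its reversal. -/
theorem exists_alphaStar_eq {h : ℕ} {H : SimpleGraph (Fin h)}
    (hedge : ∃ a b : Fin h, H.Adj a b) :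
    ∃ ℓ : ℕ, 1 ≤ ℓ ∧ ℓ < intervalChi H ∧
      (alphaStar H = (alphaPlus H ℓ : ℝ) / (ℓ * h) ∨
        alphaStar H = (alphaPlus (H.comap Fin.rev) ℓ : ℝ) / (ℓ * h)) := by
  have hfin : {x : ℝ | ∃ ℓ : ℕ, 1 ≤ ℓ ∧ ℓ < intervalChi H ∧
      (x = (alphaPlus H ℓ : ℝ) / (ℓ * h) ∨
       x = ((h : ℝ) - alphaMinus H ℓ + 1) / (ℓ * h))}.Finite := by
    refine (((Set.finite_Iio (intervalChi H)).image
      fun ℓ : ℕ => (alphaPlus H ℓ : ℝ) / (ℓ * h)).union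
      ((Set.finite_Iio (intervalChi H)).image
      fun ℓ : ℕ => ((h : ℝ) - alphaMinus H ℓ + 1) / (ℓ * h))).subset ?_
    rintro x ⟨ℓ, -, hℓ, rfl | rfl⟩
    · exact Or.inl ⟨ℓ, hℓ, rfl⟩
    · exact Or.inr ⟨ℓ, hℓ, rfl⟩
  obtain ⟨ℓ, hℓ, hχ, heq⟩ := Set.Nonempty.csInf_mem (by
    exact ⟨_, 1, le_rfl, two_le_intervalChi hedge, Or.inl rfl⟩) hfin
  refine ⟨ℓ, hℓ, hχ, heq.imp id fun he => ?_⟩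
  have hrev : (alphaMinus H ℓ : ℝ) + alphaPlus (H.comap Fin.rev) ℓ = h + 1 := by
    exact_mod_cast alphaMinus_add_alphaPlus_comap_rev H ℓ
  refine Eq.trans he ?_
  congr 1
  linarith

theorem floor_sub_one_le_of_le_add {h m ℓ α n d : ℕ} {x : ℝ} (hh : 0 < h)
    (hnm : n = h * m) (hx : x = (α : ℝ) / (ℓ * h)) (hd : n ≤ d + (m * α / ℓ + 1)) :
    (⌊(1 - x) * (n : ℝ)⌋ - 1 : ℤ) ≤ (d : ℤ) := by
  have hxn : (1 - x) * (n : ℝ) = n - ((m * α : ℕ) : ℝ) / ℓ := by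
    have hh' : (h : ℝ) ≠ 0 := by positivity
    rw [sub_mul, one_mul, hx, hnm]
    push_cast
    rw [div_mul_eq_mul_div, show (α : ℝ) * (h * m) = (m * α) * h by ring,
      mul_div_mul_right _ _ hh']
  have hdiv : ((m * α / ℓ : ℕ) : ℝ) ≤ ((m * α : ℕ) : ℝ) / ℓ := Nat.cast_div_le
  have hd' : (n : ℝ) ≤ d + ((m * α / ℓ : ℕ) + 1) := by exact_mod_cast hd
  have hfloor := Int.floor_le ((1 - x) * (n : ℝ))
  have : ((⌊(1 - x) * (n : ℝ)⌋ : ℤ) : ℝ) ≤ ((d + 1 : ℤ) : ℝ) := by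
    push_cast
    linarith
  have := Int.cast_le.mp this
  omega

theorem space_barrier (h : ℕ) (H : SimpleGraph (Fin h))
    (hedge : ∃ a b : Fin h, H.Adj a b)
    (n : ℕ) (hn : 0 < n) (hdvd : h ∣ n) :
    ∃ G : SimpleGraph (Fin n),
      (∀ v : Fin n, (⌊(1 - alphaStar H) * (n : ℝ)⌋ - 1 : ℤ) ≤ (odeg G v : ℤ)) ∧
      ¬ HasPerfectTiling H G := by
  obtain ⟨m, hnm⟩ := hdvd
  have hh : 0 < h := Nat.pos_of_ne_zero fun h0 => by simp [hnm, h0] at hn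
  have hm : 0 < m := Nat.pos_of_ne_zero fun h0 => by simp [hnm, h0] at hn
  obtain ⟨ℓ, hℓ, hχ, heq | heq⟩ := exists_alphaStar_eq hedge
  · obtain ⟨G, A, hdeg, hcopy, hA⟩ := exists_not_hasPerfectTiling_alphaPlus hm hnm hℓ hχ
    exact ⟨G, fun v => floor_sub_one_le_of_le_add hh hnm heq (hdeg v),
      not_hasPerfectTiling_of_card_inter_le A hh hnm hcopy hA⟩
  · obtain ⟨G, A, hdeg, hcopy, hA⟩ := exists_not_hasPerfectTiling_alphaMinus hm hnm hℓ hχ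
    exact ⟨G, fun v => floor_sub_one_le_of_le_add hh hnm heq (hdeg v),
      not_hasPerfectTiling_of_card_inter_le A hh hnm hcopy hA⟩
end

section
/- Let H be an ordered graph on h vertices with interval chromatic number χ<(H)=2 that has Property B. Then for every positive integer n divisible by h, there exists an ordered graph G on vertex set [n] with minimum degree δ(G) ≥ ⌊n/2⌋ − 2 that does not contain a perfect H-tiling. -/
open Finset

/-- The disjoint union of the cliques on the first `m` and on the last `n - m` vertices. -/
def twoCliques (n m : ℕ) : SimpleGraph (Fin n) where
  Adj u v := u ≠ v ∧ ((u : ℕ) < m ↔ (v : ℕ) < m)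
  symm := ⟨fun _ _ huv => ⟨huv.1.symm, huv.2.symm⟩⟩
  loopless := ⟨fun _ hu => hu.1 rfl⟩

theorem card_filter_val_lt_of_le {n m : ℕ} (hm : m ≤ n) :
    (univ.filter (fun u : Fin n => (u : ℕ) < m)).card = m := by
  rw [Fin.card_filter_val_lt, min_eq_right hm]

theorem min_sub_one_le_odeg_twoCliques {n m : ℕ} (hm : m ≤ n) (v : Fin n) :
    min m (n - m) - 1 ≤ odeg (twoCliques n m) v := by
  have hside : (twoCliques n m).neighborSet v =
      ((univ.filter (fun u : Fin n => (v : ℕ) < m ↔ (u : ℕ) < m)).erase v : Finset (Fin n)) := by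
    ext u
    simp [twoCliques, eq_comm, and_comm]
  rw [odeg, hside, Set.ncard_coe_finset, card_erase_of_mem (by simp)]
  apply Nat.sub_le_sub_right
  have hlt := card_filter_val_lt_of_le hm
  by_cases hv : (v : ℕ) < m
  · simp only [hv, true_iff]
    omega
  · simp only [hv, false_iff]
    have hsum := card_filter_add_card_filter_not (s := (univ : Finset (Fin n)))
      (fun u : Fin n => (u : ℕ) < m)
    rw [card_univ, Fintype.card_fin] at hsum
    omega

/-- No copy of an ordered graph with Property B meets both cliques of `twoCliques n m`. -/
theorem PropertyB.copy_on_one_side {h n m : ℕ} {H : SimpleGraph (Fin h)} (hB : PropertyB H)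
    {φ : Fin h → Fin n} (hφ : IsOrderedCopy H (twoCliques n m) φ) :
    (∀ a, (φ a : ℕ) < m) ∨ ∀ a, ¬ (φ a : ℕ) < m := by
  by_contra! hcross
  obtain ⟨⟨b₀, hb₀⟩, a, ha⟩ := hcross
  obtain ⟨b, hb, hmin⟩ := WellFounded.has_min (wellFounded_lt (α := Fin h))
    {b | m ≤ (φ b : ℕ)} ⟨b₀, hb₀⟩
  have hbelow : ∀ c, c < b → (φ c : ℕ) < m := fun c hc => by
    by_contra! hcm
    exact hmin c hcm hc
  have habove : ∀ d, b ≤ d → m ≤ (φ d : ℕ) := fun d hd =>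
    le_trans hb (hφ.1.monotone hd)
  have hab : a < b := by
    by_contra! hba
    exact absurd (habove a hba) (by omega)
  obtain ⟨c, d, hcd, hc, hd⟩ := hB b (by have := Fin.lt_def.1 hab; omega) b.isLt
  have hlt := (hφ.2 c d hcd).2.1 (hbelow c (Fin.lt_def.2 (by omega)))
  exact absurd (habove d (Fin.le_def.2 (by omega))) (by omega)

theorem PropertyB.dvd_of_hasPerfectTiling_twoCliques {h n m : ℕ} {H : SimpleGraph (Fin h)}
    (hB : PropertyB H) (hm : m ≤ n) (ht : HasPerfectTiling H (twoCliques n m)) : h ∣ m := by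
  obtain ⟨𝒯, hcopy, hdisj, hcover⟩ := ht
  have hfilter : univ.filter (fun u : Fin n => (u : ℕ) < m) =
      𝒯.biUnion (fun T => T.filter (fun u : Fin n => (u : ℕ) < m)) := by
    rw [← hcover, filter_biUnion]
    rfl
  rw [← card_filter_val_lt_of_le hm, hfilter, card_biUnion
    (fun S hS T hT hST => disjoint_filter_filter (show Disjoint S T from hdisj hS hT hST))]
  refine dvd_sum fun T hT => ?_
  obtain ⟨φ, hφ, rfl⟩ := hcopy T hT
  rcases hB.copy_on_one_side hφ with hall | hnone
  · rw [filter_true_of_mem (by simpa using hall), card_image_of_injective _ hφ.1.injective,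
      card_univ, Fintype.card_fin]
  · rw [filter_false_of_mem (by simpa using hnone), card_empty]
    exact dvd_zero h

theorem intervalChi_le_one {h : ℕ} (hh : h ≤ 1) (H : SimpleGraph (Fin h)) :
    intervalChi H ≤ 1 := by
  have : Subsingleton (Fin h) := Fin.subsingleton_iff_le_one.2 hh
  exact Nat.sInf_le ⟨fun _ => 0, monotone_const, fun i j hij =>
    absurd (Subsingleton.elim i j) hij.ne⟩

theorem divisibility_barrier (h : ℕ) (H : SimpleGraph (Fin h))
    (hchi : intervalChi H = 2) (hB : PropertyB H)
    (n : ℕ) (hn : 0 < n) (hdvd : h ∣ n) :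
    ∃ G : SimpleGraph (Fin n),
      (∀ v : Fin n, ((n / 2 : ℕ) : ℤ) - 2 ≤ (odeg G v : ℤ)) ∧
      ¬ HasPerfectTiling H G := by
  have hh : 2 ≤ h := by
    by_contra! hlt
    have := intervalChi_le_one (Nat.le_of_lt_succ hlt) H
    omega
  have hhn : h ≤ n := Nat.le_of_dvd hn hdvd
  obtain ⟨m, hlow, hupp, hndvd⟩ : ∃ m, n / 2 - 1 ≤ m ∧ m ≤ n / 2 ∧ ¬ h ∣ m := by
    by_cases hd : h ∣ n / 2
    · refine ⟨n / 2 - 1, le_rfl, Nat.sub_le _ _, fun hd' => ?_⟩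
      have hone : h ∣ 1 := by
        have := Nat.dvd_sub hd hd'
        rwa [show n / 2 - (n / 2 - 1) = 1 by omega] at this
      have := Nat.le_of_dvd one_pos hone
      omega
    · exact ⟨n / 2, Nat.sub_le _ _, le_rfl, hd⟩
  have hm : m ≤ n := hupp.trans (Nat.div_le_self n 2)
  refine ⟨twoCliques n m, fun v => ?_, fun ht =>
    hndvd (hB.dvd_of_hasPerfectTiling_twoCliques hm ht)⟩
  have := min_sub_one_le_odeg_twoCliques hm v
  omega
end

section
/- Let H be an ordered graph on h vertices with interval chromatic number χ<(H)=2 such that at least one of the vertices 1 and h has Property C. Then for every positive integer n divisible by h, there exists an ordered graph G on vertex set [n] with minimum degree δ(G) = ⌊n/2⌋ that does not contain a perfect H-tiling. -/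
open Finset

/-- The graph in which `v₀` is joined exactly to `B`, the set `B` is independent, and all other
pairs of vertices are adjacent. -/
def barrierGraph {n : ℕ} (v₀ : Fin n) (B : Finset (Fin n)) : SimpleGraph (Fin n) where
  Adj x y := x ≠ y ∧ (x = v₀ → y ∈ B) ∧ (y = v₀ → x ∈ B) ∧ ¬ (x ∈ B ∧ y ∈ B)
  symm := ⟨fun _ _ ⟨hne, hx, hy, hB⟩ => ⟨hne.symm, hy, hx, fun h => hB h.symm⟩⟩
  loopless := ⟨fun _ h => h.1 rfl⟩

theorem odeg_eq_card {n : ℕ} {G : SimpleGraph (Fin n)} {v : Fin n} {s : Finset (Fin n)}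
    (hs : ∀ w, G.Adj v w ↔ w ∈ s) : odeg G v = s.card := by
  have : G.neighborSet v = s := by
    ext w
    simp [hs]
  rw [odeg, this, Set.ncard_coe_finset]

theorem odeg_barrierGraph_self {n : ℕ} {v₀ : Fin n} {B : Finset (Fin n)} (hv₀ : v₀ ∉ B) :
    odeg (barrierGraph v₀ B) v₀ = B.card := by
  refine odeg_eq_card fun w => ?_
  simp only [barrierGraph]
  grind

theorem le_odeg_barrierGraph {n : ℕ} {v₀ : Fin n} {B : Finset (Fin n)} (hv₀ : v₀ ∉ B)
    (hB : B.card = n / 2) (v : Fin n) : n / 2 ≤ odeg (barrierGraph v₀ B) v := by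
  by_cases hv : v = v₀
  · rw [hv, odeg_barrierGraph_self hv₀, hB]
  by_cases hvB : v ∈ B
  · have : odeg (barrierGraph v₀ B) v = Bᶜ.card := by
      refine odeg_eq_card fun w => ?_
      simp only [barrierGraph, Finset.mem_compl]
      grind
    rw [this, Finset.card_compl, Fintype.card_fin, hB]
    omega
  · have : odeg (barrierGraph v₀ B) v = ({v, v₀} : Finset (Fin n))ᶜ.card := by
      refine odeg_eq_card fun w => ?_
      simp only [barrierGraph, Finset.mem_compl, Finset.mem_insert, Finset.mem_singleton]
      grind
    rw [this, ← hB]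
    refine Finset.card_le_card fun w hw => ?_
    simp only [Finset.mem_compl, Finset.mem_insert, Finset.mem_singleton]
    grind

/-- A perfect tiling of `barrierGraph v₀ B` is impossible if, for every strictly increasing
map `φ` and every `j` with `φ j = v₀`, some neighbour `i` of `j` and some edge `ab` of `H` are such
that `φ i ∈ B` forces both `φ a` and `φ b` into `B`. -/
theorem not_hasPerfectTiling_barrierGraph {h n : ℕ} {H : SimpleGraph (Fin h)} {v₀ : Fin n}
    {B : Finset (Fin n)}
    (hforce : ∀ φ : Fin h → Fin n, StrictMono φ → ∀ j, φ j = v₀ →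
      ∃ i a b, H.Adj i j ∧ H.Adj a b ∧ (φ i ∈ B → φ a ∈ B ∧ φ b ∈ B)) :
    ¬ HasPerfectTiling H (barrierGraph v₀ B) := by
  rintro ⟨𝒯, hcopy, -, hcover⟩
  obtain ⟨T, hT, hv₀⟩ := Finset.mem_biUnion.1 (hcover ▸ Finset.mem_univ v₀)
  obtain ⟨φ, ⟨hmono, hadj⟩, rfl⟩ := hcopy T hT
  obtain ⟨j, -, hj⟩ := Finset.mem_image.1 hv₀
  obtain ⟨i, a, b, hij, hab, himp⟩ := hforce φ hmono j hj
  exact (hadj a b hab).2.2.2 (himp ((hadj i j hij).2.2.1 hj))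

theorem PropertyCLast.exists_adj {h : ℕ} {H : SimpleGraph (Fin h)} (hC : PropertyCLast H) :
    ∃ i j a b : Fin h, (j : ℕ) + 1 = h ∧ H.Adj i j ∧ H.Adj a b ∧ i ≤ a ∧ i ≤ b ∧ a < j ∧ b < j := by
  obtain ⟨hs, a, b, hab, ha, ha', hb, hb'⟩ := hC
  obtain ⟨i, j, hij, hi, hj⟩ := Nat.sInf_mem (Nat.nonempty_of_pos_sInf hs)
  change _ = sOG H at hi
  refine ⟨i, j, a, b, hj, hij, hab, ?_, ?_, ?_, ?_⟩ <;>
    simp only [Fin.le_def, Fin.lt_def] <;> omega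

theorem PropertyCFirst.exists_adj {h : ℕ} {H : SimpleGraph (Fin h)} (hC : PropertyCFirst H) :
    ∃ i j a b : Fin h, (j : ℕ) = 0 ∧ H.Adj i j ∧ H.Adj a b ∧ a ≤ i ∧ b ≤ i ∧ j < a ∧ j < b := by
  obtain ⟨hl, a, b, hab, ha, ha', hb, hb'⟩ := hC
  by_cases hex : ∃ a b : Fin h, H.Adj a b ∧ (a : ℕ) + 1 = 1
  · have hdef := if_pos hex ▸ lOG.eq_1 H
    let S := {k | ∃ a b : Fin h, H.Adj a b ∧ (a : ℕ) + 1 = 1 ∧ (b : ℕ) + 1 = k}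
    have hbdd : BddAbove S := by
      refine ⟨h, ?_⟩
      rintro k ⟨a, b, -, -, rfl⟩
      exact b.isLt
    obtain ⟨x, y, hxy, hx⟩ := hex
    have hne : S.Nonempty := ⟨_, x, y, hxy, hx, rfl⟩
    obtain ⟨j, i, hij, hj, hi⟩ := Nat.sSup_mem hne hbdd
    rw [← hdef] at hi
    refine ⟨i, j, a, b, by omega, hij.symm, hab, ?_, ?_, ?_, ?_⟩ <;>
      simp only [Fin.le_def, Fin.lt_def] <;> omega
  · rw [lOG, if_neg hex] at hl
    omega

theorem local_barrier (h : ℕ) (H : SimpleGraph (Fin h))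
    (hchi : intervalChi H = 2)
    (hC : PropertyCFirst H ∨ PropertyCLast H)
    (n : ℕ) (hn : 0 < n) (hdvd : h ∣ n) :
    ∃ G : SimpleGraph (Fin n),
      (∀ v : Fin n, n / 2 ≤ odeg G v) ∧ (∃ v : Fin n, odeg G v = n / 2) ∧
      ¬ HasPerfectTiling H G := by
  suffices ∃ (v₀ : Fin n) (B : Finset (Fin n)), v₀ ∉ B ∧ B.card = n / 2 ∧
      ∀ φ : Fin h → Fin n, StrictMono φ → ∀ j, φ j = v₀ →
        ∃ i a b, H.Adj i j ∧ H.Adj a b ∧ (φ i ∈ B → φ a ∈ B ∧ φ b ∈ B) by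
    obtain ⟨v₀, B, hv₀, hB, hforce⟩ := this
    exact ⟨barrierGraph v₀ B, le_odeg_barrierGraph hv₀ hB,
      ⟨v₀, (odeg_barrierGraph_self hv₀).trans hB⟩, not_hasPerfectTiling_barrierGraph hforce⟩
  rcases hC with hC | hC
  · obtain ⟨i, j, a, b, hj, hij, hab, hai, hbi, hja, hjb⟩ := hC.exists_adj
    refine ⟨⟨0, hn⟩, (Finset.Ico 1 (n / 2 + 1)).attachFin fun m hm => ?_, ?_, ?_, ?_⟩
    · rw [Finset.mem_Ico] at hm
      omega
    · simp
    · simp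
    · intro φ hφ j' hj'
      obtain rfl : j = j' := by
        refine le_antisymm (by rw [Fin.le_def]; omega) (hφ.le_iff_le.1 ?_)
        rw [hj', Fin.le_def]
        exact Nat.zero_le _
      refine ⟨i, a, b, hij, hab, fun hi => ?_⟩
      have h₁ := hφ.monotone hai
      have h₂ := hφ.monotone hbi
      have h₃ := hφ hja
      have h₄ := hφ hjb
      simp only [Finset.mem_attachFin, Finset.mem_Ico, Fin.le_def, Fin.lt_def] at *
      omega
  · obtain ⟨i, j, a, b, hj, hij, hab, hia, hib, haj, hbj⟩ := hC.exists_adj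
    refine ⟨⟨n - 1, by omega⟩, (Finset.Ico (n - 1 - n / 2) (n - 1)).attachFin fun m hm => ?_,
      ?_, ?_, ?_⟩
    · rw [Finset.mem_Ico] at hm
      omega
    · simp
    · rw [Finset.card_attachFin, Nat.card_Ico]
      omega
    · intro φ hφ j' hj'
      obtain rfl : j = j' := by
        refine le_antisymm (hφ.le_iff_le.1 ?_) (by rw [Fin.le_def]; omega)
        rw [hj', Fin.le_def]
        exact Nat.le_sub_one_of_lt (φ j).isLt
      refine ⟨i, a, b, hij, hab, fun hi => ?_⟩
      have h₁ := hφ.monotone hia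
      have h₂ := hφ.monotone hib
      have h₃ := hφ haj
      have h₄ := hφ hbj
      have h₅ : (φ j : ℕ) = n - 1 := by rw [hj']
      simp only [Finset.mem_attachFin, Finset.mem_Ico, Fin.le_def, Fin.lt_def] at *
      omega
end
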